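/- Let G be a group admitting a descending sequence of subgroups G = G₀ ≥ G₁ ≥ G₂ ≥ ⋯ (not assumed normal in G) such that each G_i has finite index in G, ⋂_i G_i = {1}, and (G_i)^{(1)}_r ≤ G_{i+1} for every i. Then G is RFRS; indeed the normal cores Core_G(G_i) = ⋂_{g ∈ G} g G_i g^{-1} form a sequence witnessing the RFRS condition. -/

import Mathlib

/-- The rational derived subgroup of a subgroup `H` of `G`, as a subset of `G`:
`{x ∈ H : x ^ k ∈ [H,H] for some nonzero integer k}`. -/
def ratDer {G : Type*} [Group G] (H : Subgroup G) : Set G :=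
  {x : G | x ∈ H ∧ ∃ k : ℤ, k ≠ 0 ∧ x ^ k ∈ ⁅H, H⁆}

/-- `Gs` witnesses the RFRS condition: `Gs 0 = G`, each `Gs i` is a finite-index normal
subgroup of `G`, the sequence is descending, `⋂ i, Gs i = {1}`, and
`(Gs i)⁽¹⁾ᵣ ≤ Gs (i+1)` for every `i`. -/
def RFRSWitness {G : Type*} [Group G] (Gs : ℕ → Subgroup G) : Prop :=
  Gs 0 = ⊤ ∧ (∀ i, (Gs i).Normal) ∧ (∀ i, (Gs i).FiniteIndex) ∧
  (∀ i, Gs (i + 1) ≤ Gs i) ∧ (⨅ i, Gs i) = ⊥ ∧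
  ∀ i, ratDer (Gs i) ⊆ (Gs (i + 1) : Set G)

/-- A group is RFRS (residually finite rational solvable) if it admits an RFRS witness
sequence. -/
def IsRFRS (G : Type*) [Group G] : Prop := ∃ Gs : ℕ → Subgroup G, RFRSWitness Gs

/-- The normal core of a subgroup `K ≤ G`: `Core_G(K) = ⋂_{g ∈ G} g K g⁻¹`. -/
def core {G : Type*} [Group G] (K : Subgroup G) : Subgroup G :=
  ⨅ g : G, Subgroup.map (MulAut.conj g).toMonoidHom K

theorem core_eq_normalCore {G : Type*} [Group G] (K : Subgroup G) : core K = K.normalCore := by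
  ext x
  simp only [core, Subgroup.mem_iInf, Subgroup.mem_map_equiv, MulAut.conj_symm_apply]
  refine ⟨fun h g => ?_, fun h g => ?_⟩
  · simpa using h g⁻¹
  · simpa using h g⁻¹

theorem ratDer_mono {G : Type*} [Group G] {H K : Subgroup G} (h : H ≤ K) :
    ratDer H ⊆ ratDer K := by
  rintro x ⟨hx, k, hk, hxk⟩
  exact ⟨h hx, k, hk, Subgroup.commutator_mono h h hxk⟩

/-- The rational derived subgroup of a normal subgroup is invariant under conjugation. -/
theorem conj_mem_ratDer {G : Type*} [Group G] {N : Subgroup G} [hN : N.Normal] {x : G}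
    (hx : x ∈ ratDer N) (g : G) : g * x * g⁻¹ ∈ ratDer N := by
  obtain ⟨hxN, k, hk, hxk⟩ := hx
  refine ⟨hN.conj_mem x hxN g, k, hk, ?_⟩
  rw [conj_zpow]
  exact (inferInstance : ⁅N, N⁆.Normal).conj_mem _ hxk g

/-- If `G` admits a descending sequence of (not necessarily normal) finite-index subgroups
`G = G₀ ≥ G₁ ≥ ⋯` with trivial intersection and `(Gᵢ)⁽¹⁾ᵣ ≤ Gᵢ₊₁`, then `G` is RFRS;
indeed the normal cores `Core_G(Gᵢ)` form an RFRS witness sequence. -/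
theorem isRFRS_of_nonnormal_sequence {G : Type*} [Group G] (Gs : ℕ → Subgroup G)
    (h0 : Gs 0 = ⊤) (hdesc : ∀ i, Gs (i + 1) ≤ Gs i)
    (hfi : ∀ i, (Gs i).FiniteIndex) (hint : (⨅ i, Gs i) = ⊥)
    (hr : ∀ i, ratDer (Gs i) ⊆ (Gs (i + 1) : Set G)) :
    IsRFRS G ∧ RFRSWitness (fun i => core (Gs i)) := by
  have hwit : RFRSWitness (fun i => core (Gs i)) := by
    simp only [core_eq_normalCore]
    refine ⟨?_, fun i => inferInstance, fun i => ?_, fun i => Subgroup.normalCore_mono (hdesc i),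
      ?_, fun i x hx g => ?_⟩
    · simp only [h0, Subgroup.normalCore_eq_self]
    · have := hfi i
      infer_instance
    · rw [eq_bot_iff, ← hint]
      exact iInf_mono fun i => Subgroup.normalCore_le _
    · exact hr i (ratDer_mono (Subgroup.normalCore_le _) (conj_mem_ratDer hx g))
  exact ⟨⟨_, hwit⟩, hwit⟩
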